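/- Fix real constants A_1, A_2, B_1, B_2, C, D and an integer m ≥ 1. Then as n → ∞, (1/(m n²)) [ B_2 + (n−1) A_2 + 2(n−1) C + (n² − 3n + 2) D − (B_1 + (n−1) A_1)² ] converges to (D − A_1²)/m. Consequently, under the exchangeable-moment hypotheses of the sample-recycling variance expansion, Var(ρ̃_SR) → (D − A_1²)/m as the number of outer scenarios n → ∞ with the inner sample size m fixed. -/

import Mathlib

open Filter

/-- **Limiting variance of the sample recycling estimator as `n → ∞`.**
For fixed real constants `A₁, A₂, B₁, B₂, C, D` and fixed inner sample size
`m ≥ 1`, the variance expansion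
`(1/(m n²)) [B₂ + (n−1)A₂ + 2(n−1)C + (n²−3n+2)D − (B₁+(n−1)A₁)²]`
converges to `(D − A₁²)/m` as `n → ∞`. -/
theorem sample_recycling_variance_limit
    (m : ℕ) (hm : 1 ≤ m) (A₁ A₂ B₁ B₂ C D : ℝ) :
    Tendsto (fun n : ℕ =>
        (1 / ((m : ℝ) * (n : ℝ) ^ 2)) *
          (B₂ + ((n : ℝ) - 1) * A₂ + 2 * ((n : ℝ) - 1) * C
            + ((n : ℝ) ^ 2 - 3 * (n : ℝ) + 2) * D
            - (B₁ + ((n : ℝ) - 1) * A₁) ^ 2))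
      atTop (nhds ((D - A₁ ^ 2) / (m : ℝ))) := by
  have hinv : Tendsto (fun n : ℕ => ((n : ℝ))⁻¹) atTop (nhds 0) :=
    tendsto_inv_atTop_nhds_zero_nat
  have hpoly : Continuous fun t : ℝ =>
      ((D - A₁ ^ 2) + (A₂ + 2 * C - 3 * D - 2 * (B₁ - A₁) * A₁) * t
        + (B₂ - A₂ - 2 * C + 2 * D - (B₁ - A₁) ^ 2) * t ^ 2) / (m : ℝ) := by
    fun_prop
  have hlim := (hpoly.tendsto 0).comp hinv
  simp only [mul_zero, add_zero, ne_eq, OfNat.ofNat_ne_zero, not_false_eq_true, zero_pow] at hlim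
  refine hlim.congr' ?_
  filter_upwards [eventually_ge_atTop 1] with n hn
  have hn0 : (n : ℝ) ≠ 0 := by positivity
  have hm0 : (m : ℝ) ≠ 0 := by positivity
  simp only [Function.comp_apply]
  field_simp
  ring
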